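/- There exists a super-simple 2-(22,4,1) directed design (which has 77 blocks) whose smallest defining sets contain at least 39 blocks; in particular its smallest defining sets contain more than half of the blocks. -/

import Mathlib

open scoped Classical

/-- A block of size `k` on the point set `α`: a list of `k` distinct points. -/
def IsBlock {α : Type*} (k : ℕ) (b : List α) : Prop :=
  b.Nodup ∧ b.length = k

/-- A `t-(v,k,λ)` directed design whose point set is the whole (finite) type `α`
(so `v = Fintype.card α`): every ordered `t`-tuple of distinct points appears,
as a subsequence, in exactly `lam` blocks of the multiset `B`. -/
def IsDD {α : Type*} (t k lam : ℕ) (B : Multiset (List α)) : Prop :=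
  (∀ b ∈ B, IsBlock k b) ∧
    ∀ s : List α, s.Nodup → s.length = t →
      B.countP (fun b => s.Sublist b) = lam

/-- `S` is a defining set of the `t-(v,k,λ)` directed design with block multiset `B`:
`S` is a sub-multiset of `B`, and `B` is the unique block multiset of a
`t-(v,k,λ)DD` on the same point set containing `S`. -/
def IsDefiningSet {α : Type*} (t k lam : ℕ) (B S : Multiset (List α)) : Prop :=
  S ≤ B ∧ ∀ B' : Multiset (List α), IsDD t k lam B' → S ≤ B' → B' = B

/-- A `(v,k,t)` directed trade `T₁ - T₂` of volume `s` on the point set `α`. -/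
def IsTrade {α : Type*} (t k s : ℕ) (T₁ T₂ : Multiset (List α)) : Prop :=
  1 ≤ s ∧ Multiset.card T₁ = s ∧ Multiset.card T₂ = s ∧
    (∀ b ∈ T₁, IsBlock k b) ∧ (∀ b ∈ T₂, IsBlock k b) ∧
    (∀ b, b ∈ T₁ → b ∉ T₂) ∧
    ∀ l : List α, l.Nodup → l.length = t →
      T₁.countP (fun b => l.Sublist b) = T₂.countP (fun b => l.Sublist b)

/-- A multiset of blocks is super-simple if any two blocks (any sub-multiset
consisting of two blocks) intersect, as point sets, in at most two points. -/
def SuperSimple {α : Type*} (B : Multiset (List α)) : Prop :=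
  ∀ b₁ b₂ : List α, ({b₁, b₂} : Multiset (List α)) ≤ B →
    (b₁.toFinset ∩ b₂.toFinset).card ≤ 2

/-- A `2-(v,K,1)` design (pairwise balanced design) on the point type `β`. -/
def IsPBD {β : Type*} (K : Set ℕ) (D : Multiset (Finset β)) : Prop :=
  (∀ b ∈ D, b.card ∈ K) ∧
    ∀ x y : β, x ≠ y → D.countP (fun b => x ∈ b ∧ y ∈ b) = 1

/-- A `{K}`-GDD on the point type `β` with group multiset `Gs` and block multiset `Bs`. -/
def IsGDD {β : Type*} (K : Set ℕ) (Gs Bs : Multiset (Finset β)) : Prop :=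
  (∀ x : β, Gs.countP (fun G => x ∈ G) = 1) ∧
    (∀ b ∈ Bs, b.card ∈ K) ∧
    (∀ b ∈ Bs, ∀ G ∈ Gs, (b ∩ G).card ≤ 1) ∧
    (∀ x y : β, x ≠ y → (∀ G ∈ Gs, ¬(x ∈ G ∧ y ∈ G)) →
      Bs.countP (fun b => x ∈ b ∧ y ∈ b) = 1)

/-- A `4`-DGDD on the point type `β` with group multiset `Gs` and block multiset `B`:
the groups partition the points, no block meets a group twice, and every ordered pair
of points from distinct groups appears in exactly one block. -/
def IsDGDD {β : Type*} (Gs : Multiset (Finset β)) (B : Multiset (List β)) : Prop :=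
  (∀ x : β, Gs.countP (fun G => x ∈ G) = 1) ∧
    (∀ b ∈ B, IsBlock 4 b) ∧
    (∀ b ∈ B, ∀ G ∈ Gs, (b.toFinset ∩ G).card ≤ 1) ∧
    (∀ x y : β, x ≠ y → (∀ G ∈ Gs, ¬(x ∈ G ∧ y ∈ G)) →
      B.countP (fun b => [x, y].Sublist b) = 1)

/-- `S` is a defining set of the `4`-DGDD with groups `Gs` and block multiset `B`. -/
def IsDGDDDefiningSet {β : Type*} (Gs : Multiset (Finset β)) (B S : Multiset (List β)) : Prop :=
  S ≤ B ∧ ∀ B' : Multiset (List β), IsDGDD Gs B' → S ≤ B' → B' = B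

theorem coe_countP_sublist {α : Type*} [DecidableEq α] (L : List (List α)) (l : List α)
    [DecidablePred fun b => l.Sublist b] :
    (L : Multiset (List α)).countP (fun b => l.Sublist b) = L.countP l.isSublist := by
  rw [Multiset.coe_countP]
  exact List.countP_congr fun b _ => by rw [decide_eq_true_iff, List.isSublist_iff_sublist]

theorem IsBlock.map {α : Type*} {k : ℕ} {b : List α} (h : IsBlock k b) (f : Equiv.Perm α) :
    IsBlock k (b.map f) :=
  ⟨h.1.map f.injective, by rw [List.length_map, h.2]⟩

theorem map_sublist_map_iff {α : Type*} (f : Equiv.Perm α) {l b : List α} :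
    (l.map f).Sublist (b.map f) ↔ l.Sublist b :=
  ⟨fun h => by simpa using h.map f.symm, fun h => h.map f⟩

theorem countP_map_sublist {α : Type*} (f : Equiv.Perm α) (B : Multiset (List α))
    (l : List α) :
    (B.map (List.map f)).countP (fun b => (l.map f).Sublist b) =
      B.countP (fun b => l.Sublist b) := by
  rw [Multiset.countP_map, Multiset.countP_eq_card_filter]
  exact congrArg _ (Multiset.filter_congr fun b _ => map_sublist_map_iff f)

theorem IsTrade.map {α : Type*} {t k s : ℕ} {T₁ T₂ : Multiset (List α)}
    (h : IsTrade t k s T₁ T₂) (f : Equiv.Perm α) :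
    IsTrade t k s (T₁.map (List.map f)) (T₂.map (List.map f)) := by
  obtain ⟨hs, hc₁, hc₂, hb₁, hb₂, hne, hcount⟩ := h
  refine ⟨hs, by simpa, by simpa, ?_, ?_, ?_, fun l hl hlen => ?_⟩
  · simpa using fun b hb => (hb₁ b hb).map f
  · simpa using fun b hb => (hb₂ b hb).map f
  · intro b hb hb'
    obtain ⟨c, hc, rfl⟩ := Multiset.mem_map.mp hb
    exact hne c hc ((Multiset.mem_map_of_injective f.injective.list_map).mp hb')
  · obtain ⟨l, rfl⟩ : ∃ l', l = l'.map f := ⟨l.map f.symm, by simp⟩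
    rw [countP_map_sublist, countP_map_sublist]
    exact hcount l (List.Nodup.of_map f hl) (by simpa using hlen)

/-- Two blocks `a`, `b` may be traded for `a'`, `b'` if both pairs of blocks contain the same
ordered pairs of points. -/
theorem isTrade_pair {α : Type*} [DecidableEq α] {k : ℕ} {a b a' b' : List α}
    (hblock : ∀ c ∈ [a, b, a', b'], c.Nodup ∧ c.length = k)
    (hne : a ≠ a' ∧ a ≠ b' ∧ b ≠ a' ∧ b ≠ b')
    (h : ∀ x y : α, x ≠ y →
      [a, b].countP [x, y].isSublist = [a', b'].countP [x, y].isSublist) :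
    IsTrade 2 k 2 {a, b} {a', b'} := by
  simp only [List.mem_cons, List.not_mem_nil, or_false, forall_eq_or_imp, forall_eq] at hblock
  obtain ⟨ha, hb, ha', hb'⟩ := hblock
  refine ⟨by norm_num, by simp, by simp, ?_, ?_, ?_, fun l hl hlen => ?_⟩
  · simpa [IsBlock] using ⟨ha, hb⟩
  · simpa [IsBlock] using ⟨ha', hb'⟩
  · simpa using ⟨⟨hne.1, hne.2.1⟩, hne.2.2⟩
  · obtain ⟨x, y, rfl⟩ := List.length_eq_two.mp hlen
    have hxy := h x y (by simpa using hl)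
    rw [← coe_countP_sublist, ← coe_countP_sublist] at hxy
    convert hxy <;> rfl

/-- Every defining set meets every trade contained in the design. -/
theorem IsDefiningSet.exists_mem_of_isTrade {α : Type*} {t k lam s : ℕ}
    {B S T₁ T₂ : Multiset (List α)} (hS : IsDefiningSet t k lam B S) (hB : IsDD t k lam B)
    (hT : IsTrade t k s T₁ T₂) (hle : T₁ ≤ B) : ∃ b ∈ T₁, b ∈ S := by
  by_contra! hdisj
  obtain ⟨hs, hcard, -, -, hblock, hne, hcount⟩ := hT
  have hsplit : B - T₁ + T₁ = B := Multiset.sub_add_cancel hle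
  have hSle : S ≤ B - T₁ := by
    rw [Multiset.le_iff_count]
    intro b
    rw [Multiset.count_sub]
    by_cases hb : b ∈ T₁
    · simp [Multiset.count_eq_zero_of_notMem (hdisj b hb)]
    · simpa [Multiset.count_eq_zero_of_notMem hb] using Multiset.count_le_of_le b hS.1
  have hDD : IsDD t k lam (B - T₁ + T₂) := by
    refine ⟨fun b hb => ?_, fun l hl hlen => ?_⟩
    · rcases Multiset.mem_add.mp hb with hb | hb
      · exact hB.1 b (Multiset.mem_of_le (Multiset.sub_le_self _ _) hb)
      · exact hblock b hb
    · rw [Multiset.countP_add, ← hcount l hl hlen, ← Multiset.countP_add, hsplit]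
      exact hB.2 l hl hlen
  have heq := hS.2 _ hDD (hSle.trans (Multiset.le_add_right _ _))
  have hT : T₂ = T₁ := add_left_cancel (heq.trans hsplit.symm)
  obtain ⟨b, hb⟩ := Multiset.card_pos_iff_exists_mem.mp (hcard ▸ hs : 0 < Multiset.card T₁)
  exact hne b hb (hT ▸ hb)

/-- The base blocks of a `2-(22,4,1)` directed design invariant under `x ↦ x + 2`. -/
def baseBlock : Fin 7 → List (Fin 22) :=
  ![[1, 10, 12, 3], [0, 14, 11, 18], [0, 16, 1, 21], [0, 3, 9, 6],
    [1, 2, 14, 0], [11, 6, 1, 16], [21, 17, 9, 3]]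

/-- The translation of the points by `2 * i`. -/
def shift (i : Fin 11) : Equiv.Perm (Fin 22) :=
  Equiv.addRight (Fin.ofNat 22 (2 * i))

/-- The blocks of the design, indexed by base block and translation. -/
def designBlock (p : Fin 7 × Fin 11) : List (Fin 22) :=
  (baseBlock p.1).map (shift p.2)

/-- The list of blocks of the design. -/
def designList : List (List (Fin 22)) :=
  (List.finRange 7 ×ˢ List.finRange 11).map designBlock

/-- The block multiset of the design. -/
def design : Multiset (List (Fin 22)) :=
  designList

theorem shift_add (i k : Fin 11) (x : Fin 22) : shift (i + k) x = shift k (shift i x) := by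
  revert i k x
  decide +kernel

theorem map_shift_designBlock (j : Fin 7) (i k : Fin 11) :
    (designBlock (j, i)).map (shift k) = designBlock (j, i + k) := by
  simp [designBlock, Function.comp_def, shift_add]

theorem designBlock_injective : Function.Injective designBlock := by
  unfold Function.Injective
  decide +kernel

theorem design_nodup : design.Nodup :=
  Multiset.coe_nodup.mpr
    (((List.nodup_finRange 7).product (List.nodup_finRange 11)).map designBlock_injective)

theorem mem_design {b : List (Fin 22)} : b ∈ design ↔ ∃ p, designBlock p = b := by
  simp [design, designList]

theorem card_design : Multiset.card design = 77 := by
  rw [design, Multiset.coe_card]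
  decide +kernel

theorem map_shift_design (k : Fin 11) : design.map (List.map (shift k)) = design := by
  refine Multiset.eq_of_le_of_card_le ?_ (Multiset.card_map _ _).ge
  rw [Multiset.le_iff_subset (design_nodup.map (shift k).injective.list_map)]
  intro b hb
  obtain ⟨c, hc, rfl⟩ := Multiset.mem_map.mp hb
  obtain ⟨⟨j, i⟩, rfl⟩ := mem_design.mp hc
  exact mem_design.mpr ⟨(j, i + k), (map_shift_designBlock j i k).symm⟩

theorem isDD_design : IsDD 2 4 1 design := by
  refine ⟨fun b hb => ?_, fun l hl hlen => ?_⟩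
  · obtain ⟨⟨j, i⟩, rfl⟩ := mem_design.mp hb
    have h : ∀ j, (baseBlock j).Nodup ∧ (baseBlock j).length = 4 := by decide +kernel
    exact IsBlock.map (h j) (shift i)
  · obtain ⟨x, y, rfl⟩ := List.length_eq_two.mp hlen
    have h : ∀ x : Fin 2, ∀ y, x.castLE (by decide) ≠ y →
        designList.countP [x.castLE (by decide), y].isSublist = 1 := by
      decide +kernel
    have hx : ∀ x, ∃ (x₀ : Fin 2) (k : Fin 11), shift k (x₀.castLE (by decide)) = x := by
      decide +kernel
    obtain ⟨x₀, k, rfl⟩ := hx x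
    obtain ⟨y₀, rfl⟩ := (shift k).surjective y
    have hxy := h x₀ y₀ (by rintro rfl; simp at hl)
    rw [← coe_countP_sublist] at hxy
    rw [← map_shift_design k]
    refine (countP_map_sublist (shift k) design [_, y₀]).trans ?_
    convert hxy
    rfl

theorem superSimple_design : SuperSimple design := by
  intro b₁ b₂ h
  have hne : b₁ ≠ b₂ := by simpa using Multiset.nodup_of_le h design_nodup
  obtain ⟨⟨j, i⟩, rfl⟩ := mem_design.mp (Multiset.mem_of_le h (by simp : b₁ ∈ _))
  obtain ⟨⟨k, m⟩, rfl⟩ := mem_design.mp (Multiset.mem_of_le h (by simp : b₂ ∈ _))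
  have hp : designBlock (j, i) = (designBlock (j, 0)).map (shift i) := by
    rw [map_shift_designBlock, zero_add]
  have hq : designBlock (k, m) = (designBlock (k, m - i)).map (shift i) := by
    rw [map_shift_designBlock, sub_add_cancel]
  have key : ∀ j q, (j, 0) ≠ q →
      ((designBlock (j, 0)).filter (fun x => (designBlock q).contains x)).length ≤ 2 := by
    decide +kernel
  refine le_trans (le_trans (Finset.card_le_card ?_) (List.toFinset_card_le
    (((designBlock (j, 0)).filter
      (fun x => (designBlock (k, m - i)).contains x)).map (shift i)))) ?_
  · intro x
    simp only [hp, hq, Finset.mem_inter, List.mem_toFinset, List.mem_map, List.mem_filter,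
      List.contains_iff_mem]
    rintro ⟨⟨y, hy, rfl⟩, z, hz, hzy⟩
    exact ⟨y, ⟨hy, (shift i).injective hzy ▸ hz⟩, rfl⟩
  · rw [List.length_map]
    exact key j _ fun e => hne (by rw [hp, hq, e])

theorem pair_le_design {p q : Fin 7 × Fin 11} (h : p ≠ q) :
    ({designBlock p, designBlock q} : Multiset (List (Fin 22))) ≤ design := by
  rw [Multiset.le_iff_subset (by simpa using designBlock_injective.ne h)]
  intro b hb
  simp only [Multiset.insert_eq_cons, Multiset.mem_cons, Multiset.mem_singleton] at hb
  rcases hb with rfl | rfl <;> exact mem_design.mpr ⟨_, rfl⟩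

/-- Consecutive translates of the first base block meet in two points which are adjacent in
both blocks. -/
theorem exists_isTrade_cycle (i : Fin 11) :
    ∃ T, IsTrade 2 4 2 {designBlock (0, i), designBlock (0, i + 1)} T := by
  have h : IsTrade 2 4 2 {[1, 10, 12, 3], [3, 12, 14, 5]}
      {([1, 10, 3, 12] : List (Fin 22)), [12, 3, 14, 5]} :=
    isTrade_pair (by decide) (by decide) (by decide +kernel)
  refine ⟨Multiset.map (List.map (shift i)) {[1, 10, 3, 12], [12, 3, 14, 5]}, ?_⟩
  convert h.map (shift i) using 1
  have h₁ : designBlock (0, 1) = [3, 12, 14, 5] := by decide +kernel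
  rw [add_comm i, ← map_shift_designBlock, h₁]
  simp [designBlock, baseBlock]

/-- If two base blocks form a trade, then so do their translates. -/
theorem exists_isTrade_translate {j k : Fin 7}
    (h : ∃ T, IsTrade 2 4 2 {baseBlock j, baseBlock k} T) (i : Fin 11) :
    ∃ T, IsTrade 2 4 2 {designBlock (j, i), designBlock (k, i)} T := by
  obtain ⟨T, hT⟩ := h
  exact ⟨_, by simpa [designBlock] using hT.map (shift i)⟩

theorem exists_isTrade_one_four : ∃ T, IsTrade 2 4 2 {baseBlock 1, baseBlock 4} T :=
  ⟨{[14, 0, 11, 18], [1, 2, 0, 14]},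
    isTrade_pair (by decide +kernel) (by decide +kernel) (by decide +kernel)⟩

theorem exists_isTrade_two_five : ∃ T, IsTrade 2 4 2 {baseBlock 2, baseBlock 5} T :=
  ⟨{[0, 1, 16, 21], [11, 6, 16, 1]},
    isTrade_pair (by decide +kernel) (by decide +kernel) (by decide +kernel)⟩

theorem exists_isTrade_three_six : ∃ T, IsTrade 2 4 2 {baseBlock 3, baseBlock 6} T :=
  ⟨{[0, 9, 3, 6], [21, 17, 3, 9]},
    isTrade_pair (by decide +kernel) (by decide +kernel) (by decide +kernel)⟩

theorem one_le_count_add_count {S : Multiset (List (Fin 22))}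
    (hS : IsDefiningSet 2 4 1 design S) {p q : Fin 7 × Fin 11}
    (hpq : p ≠ q) (hT : ∃ T, IsTrade 2 4 2 {designBlock p, designBlock q} T) :
    1 ≤ S.count (designBlock p) + S.count (designBlock q) := by
  obtain ⟨T, hT⟩ := hT
  obtain ⟨b, hb, hbS⟩ := hS.exists_mem_of_isTrade isDD_design hT (pair_le_design hpq)
  have hpos := Multiset.count_pos.mpr hbS
  simp only [Multiset.insert_eq_cons, Multiset.mem_cons, Multiset.mem_singleton] at hb
  rcases hb with rfl | rfl <;> omega

theorem card_eq_sum_count {S : Multiset (List (Fin 22))} (hS : S ≤ design) :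
    Multiset.card S = ∑ j : Fin 7, ∑ i : Fin 11, S.count (designBlock (j, i)) := by
  rw [← Fintype.sum_prod_type' (fun j i => S.count (designBlock (j, i))),
    ← Multiset.sum_count_eq_card (s := Finset.univ.image designBlock),
    Finset.sum_image designBlock_injective.injOn]
  intro b hb
  obtain ⟨p, rfl⟩ := mem_design.mp (Multiset.mem_of_le hS hb)
  exact Finset.mem_image_of_mem _ (Finset.mem_univ p)

theorem le_card_of_isDefiningSet_design {S : Multiset (List (Fin 22))}
    (hS : IsDefiningSet 2 4 1 design S) : 39 ≤ Multiset.card S := by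
  set c : Fin 7 → Fin 11 → ℕ := fun j i => S.count (designBlock (j, i)) with hc
  have hcycle : 11 ≤ ∑ i, c 0 i + ∑ i, c 0 i := by
    calc 11 = ∑ _i : Fin 11, 1 := by simp
      _ ≤ ∑ i, (c 0 i + c 0 (i + 1)) := Finset.sum_le_sum fun i _ =>
          one_le_count_add_count hS (by simp) (exists_isTrade_cycle i)
      _ = ∑ i, c 0 i + ∑ i, c 0 i := by
          rw [Finset.sum_add_distrib]
          exact congrArg _ (Equiv.sum_comp (Equiv.addRight (1 : Fin 11)) (c 0))
  have hmatching {j k : Fin 7} (hjk : j ≠ k)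
      (h : ∃ T, IsTrade 2 4 2 {baseBlock j, baseBlock k} T) :
      11 ≤ ∑ i, c j i + ∑ i, c k i := by
    rw [← Finset.sum_add_distrib]
    calc 11 = ∑ _i : Fin 11, 1 := by simp
      _ ≤ _ := Finset.sum_le_sum fun i _ =>
          one_le_count_add_count hS (by simp [hjk]) (exists_isTrade_translate h i)
  have h₁ := hmatching (by decide) exists_isTrade_one_four
  have h₂ := hmatching (by decide) exists_isTrade_two_five
  have h₃ := hmatching (by decide) exists_isTrade_three_six
  have hsum : Multiset.card S = ∑ j, ∑ i, c j i := card_eq_sum_count hS.1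
  rw [Fin.sum_univ_seven] at hsum
  omega

/-- There is a super-simple `2-(22,4,1)DD` (with 77 blocks)
whose every defining set contains at least 39 blocks (in particular, more than
half of the blocks). -/
theorem stmt16 :
    ∃ B : Multiset (List (Fin 22)),
      IsDD 2 4 1 B ∧ SuperSimple B ∧ Multiset.card B = 77 ∧
      ∀ S : Multiset (List (Fin 22)), IsDefiningSet 2 4 1 B S →
        39 ≤ Multiset.card S :=
  ⟨design, isDD_design, superSimple_design, card_design,
    fun _ => le_card_of_isDefiningSet_design⟩
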